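/- Let n ≥ 11 and let T be a tree of order n that attains the second-largest number of dissociation sets among all trees of order n (i.e., T maximizes d among all trees of order n that do not attain the maximum value of d over trees of order n). Then every longest path of T has exactly 5 vertices, i.e., T has diameter 4. -/

import Mathlib

open SimpleGraph

/-- `S` is a dissociation set of `G`: every vertex of `S` has at most one neighbor in `S`. -/
def IsDissociation {V : Type*} (G : SimpleGraph V) (S : Set V) : Prop :=
  ∀ v ∈ S, (G.neighborSet v ∩ S).Subsingleton

/-- `d(G)`: the number of dissociation sets of `G`. -/
noncomputable def dissocNum {V : Type*} (G : SimpleGraph V) : ℕ :=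
  Nat.card {S : Set V // IsDissociation G S}

/-- `K_{r+1} ∗ (K_{s₀+1} ∪ ⋯ ∪ K_{sₜ+1})`: the hub `Sum.inl 0` of the complete graph
`K_{r+1}` is joined to the vertex `0` of each complete component. -/
def starGraph (r : ℕ) (s : List ℕ) :
    SimpleGraph (Fin (r + 1) ⊕ (Σ i : Fin s.length, Fin (s.get i + 1))) where
  Adj x y := x ≠ y ∧
    (Sum.elim (fun _ => (none : Option (Fin s.length))) (fun p => some p.1) x =
        Sum.elim (fun _ => (none : Option (Fin s.length))) (fun p => some p.1) y ∨
      (x = Sum.inl 0 ∧ ∃ i, y = Sum.inr ⟨i, 0⟩) ∨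
      (y = Sum.inl 0 ∧ ∃ i, x = Sum.inr ⟨i, 0⟩))
  symm := by
    constructor
    rintro x y ⟨h1, h2⟩
    refine ⟨h1.symm, ?_⟩
    rcases h2 with h | h | h
    · exact Or.inl h.symm
    · exact Or.inr (Or.inr h)
    · exact Or.inr (Or.inl h)
  loopless := ⟨fun x h => h.1 rfl⟩

/-- `T` attains the second-largest number of dissociation sets among all trees of order `n`:
`T` is a tree of order `n` that does not attain the maximum of `d` over trees of order `n`,
and `d(T)` is largest among such trees. -/
def SecondLargestTree (n : ℕ) (T : SimpleGraph (Fin n)) : Prop :=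
  T.IsTree ∧
  (∃ T' : SimpleGraph (Fin n), T'.IsTree ∧ dissocNum T < dissocNum T') ∧
  (∀ T' : SimpleGraph (Fin n), T'.IsTree →
    (∃ T'' : SimpleGraph (Fin n), T''.IsTree ∧ dissocNum T' < dissocNum T'') →
    dissocNum T' ≤ dissocNum T)

/-! ### Dissociation sets and a hub vertex -/

/-- The subset of `V` encoded by either a set avoiding `c`, or by a subset of `W` together with
at most one element of `L`, to which `c` is added. -/
def hubSet {V : Type*} (c : V) (W L : Set V) :
    Set {x : V // x ≠ c} ⊕ (Set W × Option L) → Set V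
  | Sum.inl A => {x | ∃ h : x ≠ c, ⟨x, h⟩ ∈ A}
  | Sum.inr (A, o) => {x | x = c ∨ (∃ h : x ∈ W, ⟨x, h⟩ ∈ A) ∨ ∃ y : L, o = some y ∧ x = y}

theorem card_hubSet_domain {V : Type*} [Fintype V] (c : V) (W L : Set V) :
    Nat.card (Set {x : V // x ≠ c} ⊕ (Set W × Option L)) =
      2 ^ (Fintype.card V - 1) + 2 ^ W.ncard * (L.ncard + 1) := by
  classical
  rw [Nat.card_sum, Nat.card_prod, Set.ncard, Set.ncard]
  simp [Nat.card_eq_fintype_card, Set.encard, ENat.card_eq_coe_fintype_card]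

theorem hubSet_injective {V : Type*} {c : V} {W L : Set V} (hcW : c ∉ W) (hcL : c ∉ L)
    (hWL : Disjoint W L) : Function.Injective (hubSet c W L) := by
  have hd : ∀ x ∈ W, x ∉ L := fun x h1 h2 => Set.disjoint_left.1 hWL h1 h2
  have hc : ∀ A, c ∉ hubSet c W L (Sum.inl A) := fun A ⟨h, _⟩ => h rfl
  have hc' : ∀ B, c ∈ hubSet c W L (Sum.inr B) := fun B => Or.inl rfl
  rintro (A | ⟨A, o⟩) (B | ⟨B, q⟩) h
  · congr 1
    ext ⟨x, hx⟩
    have := Set.ext_iff.1 h x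
    simpa [hubSet, hx] using this
  · exact absurd (h ▸ hc' _) (hc A)
  · exact absurd (h ▸ hc' (A, o)) (hc B)
  · have h1 : A = B := by
      ext ⟨x, hx⟩
      have := Set.ext_iff.1 h x
      have hxc : x ≠ c := fun e => hcW (e ▸ hx)
      have hL : ∀ y : L, x ≠ y := fun y e => hd x hx (e ▸ y.2)
      simpa only [hubSet, Set.mem_ofPred_eq, hxc, hx, exists_true_left, hL, and_false, exists_false,
        or_false, false_or] using this
    have h2 : o = q := by
      ext y
      have := Set.ext_iff.1 h y
      have hyc : (y : V) ≠ c := fun e => hcL (e ▸ y.2)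
      have hyW : (y : V) ∉ W := fun e => hd _ e y.2
      simp only [hubSet, Set.mem_ofPred_eq, hyc, false_or, hyW, IsEmpty.exists_iff] at this
      constructor
      · intro e
        obtain ⟨z, hz, hyz⟩ := this.1 ⟨y, e, rfl⟩
        rw [hz, Subtype.ext hyz]
      · intro e
        obtain ⟨z, hz, hyz⟩ := this.2 ⟨y, e, rfl⟩
        rw [hz, Subtype.ext hyz]
    rw [h1, h2]

/-- If `c` is adjacent to all other vertices outside `W`, then `G` has few dissociation sets. -/
theorem dissocNum_le_of_hub {V : Type*} [Fintype V] (G : SimpleGraph V) (c : V) (W : Set V)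
    (hcW : c ∉ W) (hadj : ∀ x, x ≠ c → x ∉ W → G.Adj c x) :
    dissocNum G ≤ 2 ^ (Fintype.card V - 1) + 2 ^ W.ncard * (Fintype.card V - W.ncard) := by
  classical
  have hL : ((insert c W)ᶜ : Set V).ncard + 1 = Fintype.card V - W.ncard := by
    have h1 := Set.ncard_add_ncard_compl (insert c W)
    rw [Set.ncard_insert_of_notMem hcW, Nat.card_eq_fintype_card] at h1
    omega
  rw [← hL, ← card_hubSet_domain c]
  have key : ∀ S : {S : Set V // IsDissociation G S},
      ∃ t, hubSet c W ((insert c W)ᶜ) t = S := by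
    rintro ⟨S, hS⟩
    by_cases hc : c ∈ S
    · by_cases hy : ∃ y ∈ S, y ∉ insert c W
      · obtain ⟨y, hyS, hy⟩ := hy
        refine ⟨Sum.inr ({x | (x : V) ∈ S}, some ⟨y, hy⟩), ?_⟩
        have hy' : y ≠ c ∧ y ∉ W := by simpa using hy
        ext x
        constructor
        · rintro (rfl | ⟨h, h'⟩ | ⟨z, hz, rfl⟩)
          · exact hc
          · exact h'
          · rw [← Option.some.inj hz]
            exact hyS
        · intro hx
          by_cases hxc : x = c
          · exact Or.inl hxc
          by_cases hxW : x ∈ W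
          · exact Or.inr (Or.inl ⟨hxW, hx⟩)
          · exact Or.inr (Or.inr ⟨_, rfl,
              hS c hc ⟨hadj x hxc hxW, hx⟩ ⟨hadj y hy'.1 hy'.2, hyS⟩⟩)
      · push Not at hy
        refine ⟨Sum.inr ({x | (x : V) ∈ S}, none), ?_⟩
        ext x
        constructor
        · rintro (rfl | ⟨h, h'⟩ | ⟨z, hz, rfl⟩)
          · exact hc
          · exact h'
          · simp at hz
        · intro hx
          rcases hy x hx with h | h
          · exact Or.inl h
          · exact Or.inr (Or.inl ⟨h, hx⟩)
    · refine ⟨Sum.inl {x | (x : V) ∈ S}, ?_⟩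
      ext x
      exact ⟨fun ⟨_, h⟩ => h, fun h => ⟨fun e => hc (e ▸ h), h⟩⟩
  choose t ht using key
  exact Nat.card_le_card_of_injective t fun A B h => Subtype.ext (by rw [← ht A, h, ht B])

/-- If every component of `G - c` has at most two vertices, then `G` has many dissociation
sets. -/
theorem le_dissocNum_of_hub {V : Type*} [Fintype V] (G : SimpleGraph V) (c : V) (W L : Set V)
    (hcW : c ∉ W) (hcL : c ∉ L) (hWL : Disjoint W L)
    (hsub : ∀ v, v ≠ c → (G.neighborSet v \ {c}).Subsingleton)
    (hW : ∀ w ∈ W, ¬ G.Adj w c) (hL : ∀ l ∈ L, ∀ x, G.Adj l x → x = c) :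
    2 ^ (Fintype.card V - 1) + 2 ^ W.ncard * (L.ncard + 1) ≤ dissocNum G := by
  classical
  rw [← card_hubSet_domain c]
  have key : ∀ t, IsDissociation G (hubSet c W L t) := by
    rintro (A | ⟨A, o⟩)
    · rintro v ⟨hv, -⟩ x ⟨hx, hxc, -⟩ y ⟨hy, hyc, -⟩
      exact hsub v hv ⟨hx, hxc⟩ ⟨hy, hyc⟩
    · rintro v (rfl | ⟨hv, -⟩ | ⟨l, ho, rfl⟩)
      · have aux : ∀ x, G.Adj v x → x ∈ hubSet v W L (Sum.inr (A, o)) →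
            ∃ z : L, o = some z ∧ x = z := by
          rintro x hx (rfl | ⟨h, -⟩ | h)
          · exact absurd hx (G.loopless.irrefl _)
          · exact absurd hx.symm (hW _ h)
          · exact h
        rintro x ⟨hx, hxS⟩ y ⟨hy, hyS⟩
        obtain ⟨z, hz, rfl⟩ := aux x hx hxS
        obtain ⟨z', hz', rfl⟩ := aux y hy hyS
        exact congrArg Subtype.val (Option.some.inj (hz.symm.trans hz'))
      · rintro x ⟨hx, -⟩ y ⟨hy, -⟩
        have hx' : x ≠ c := fun e => hW v hv (e ▸ hx)
        have hy' : y ≠ c := fun e => hW v hv (e ▸ hy)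
        exact hsub v (fun e => hcW (e ▸ hv)) ⟨hx, hx'⟩ ⟨hy, hy'⟩
      · rintro x ⟨hx, -⟩ y ⟨hy, -⟩
        rw [hL l l.2 x hx, hL l l.2 y hy]
  exact Nat.card_le_card_of_injective (fun t => ⟨hubSet c W L t, key t⟩)
    fun A B h => hubSet_injective hcW hcL hWL (congrArg Subtype.val h)

/-! ### Spiders -/

/-- The neighbour of `i > 0` towards the hub `0` in the spider with `k` legs of length two. -/
def spiderParent (k i : ℕ) : ℕ := if i % 2 = 0 ∧ i ≤ 2 * k then i - 1 else 0

theorem spiderParent_lt {k i : ℕ} (hi : i ≠ 0) : spiderParent k i < i := by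
  unfold spiderParent
  split_ifs <;> omega

/-- The tree on `Fin n` with hub `0`, the `k` legs `0, 2 i + 1, 2 i + 2` of length two, and all
other vertices being leaves attached to the hub. -/
def spider (n k : ℕ) : SimpleGraph (Fin n) where
  Adj i j := (i.val ≠ 0 ∧ j.val = spiderParent k i) ∨ (j.val ≠ 0 ∧ i.val = spiderParent k j)
  symm := ⟨fun _ _ h => h.symm⟩
  loopless := ⟨fun _ h => h.elim (fun h => (spiderParent_lt h.1).ne' h.2)
    fun h => (spiderParent_lt h.1).ne' h.2⟩

theorem spider_isTree (n k : ℕ) (hn : 0 < n) : (spider n k).IsTree := by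
  classical
  have hreach : ∀ m (hm : m < n), (spider n k).Reachable ⟨m, hm⟩ ⟨0, hn⟩ := by
    intro m
    induction m using Nat.strong_induction_on with
    | _ m ih =>
      intro hm
      by_cases h0 : m = 0
      · subst h0
        rfl
      · have hlt := spiderParent_lt (k := k) h0
        have hadj : (spider n k).Adj ⟨m, hm⟩ ⟨spiderParent k m, hlt.trans hm⟩ := Or.inl ⟨h0, rfl⟩
        exact hadj.reachable.trans (ih _ hlt _)
  have hconn : (spider n k).Connected := by
    have : Nonempty (Fin n) := ⟨⟨0, hn⟩⟩
    exact ⟨fun x y => (hreach x x.2).trans (hreach y y.2).symm⟩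
  rw [SimpleGraph.isTree_iff_connected_and_card]
  refine ⟨hconn, le_antisymm ?_ hconn.card_vert_le_card_edgeSet_add_one⟩
  have hsub : ((spider n k).edgeSet) ⊆
      Set.range (fun i : {i : Fin n // i ≠ ⟨0, hn⟩} =>
        s(i.1, ⟨spiderParent k i.1,
          (spiderParent_lt (fun h => i.2 (Fin.ext h))).trans i.1.2⟩)) := by
    intro e
    induction e using Sym2.ind with
    | _ x y =>
      rintro (h | h)
      · exact ⟨⟨x, fun e => h.1 (by rw [e])⟩, by
          exact Sym2.eq_iff.2 (Or.inl ⟨rfl, Fin.ext h.2.symm⟩)⟩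
      · exact ⟨⟨y, fun e => h.1 (by rw [e])⟩, by
          exact Sym2.eq_iff.2 (Or.inr ⟨rfl, Fin.ext h.2.symm⟩)⟩
  have h1 := Set.ncard_le_ncard hsub (Set.toFinite _)
  have h2 : (Set.range (fun i : {i : Fin n // i ≠ ⟨0, hn⟩} =>
        s(i.1, (⟨spiderParent k i.1,
          (spiderParent_lt (fun h => i.2 (Fin.ext h))).trans i.1.2⟩ : Fin n)))).ncard ≤ n - 1 := by
    refine (Finite.card_range_le _).trans ?_
    simp [Nat.card_eq_fintype_card]
  have h3 : Nat.card (spider n k).edgeSet ≤ n - 1 := h1.trans h2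
  rw [Nat.card_eq_fintype_card (α := Fin n), Fintype.card_fin]
  omega

/-- The far ends of the legs of length two of a spider. -/
def spiderFeet (n k : ℕ) : Set (Fin n) := {i | i.val ≠ 0 ∧ i.val % 2 = 0 ∧ i.val ≤ 2 * k}

theorem ncard_spiderFeet {n k : ℕ} (hn : 2 * k < n) : (spiderFeet n k).ncard = k := by
  have h : spiderFeet n k = Set.range (fun j : Fin k => (⟨2 * j + 2, by omega⟩ : Fin n)) := by
    ext i
    simp only [spiderFeet, Set.mem_ofPred_eq, Set.mem_range, Fin.ext_iff]
    constructor
    · rintro ⟨h0, h1, h2⟩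
      exact ⟨⟨i.val / 2 - 1, by omega⟩, by simp; omega⟩
    · rintro ⟨j, hj⟩
      omega
  rw [h, ← Set.image_univ, Set.ncard_image_of_injective, Set.ncard_univ, Nat.card_eq_fintype_card,
    Fintype.card_fin]
  intro a b hab
  simp only [Fin.mk.injEq] at hab
  exact Fin.ext (by omega)

theorem dissocNum_spider_le {n k : ℕ} (hn : 2 * k < n) :
    dissocNum (spider n k) ≤ 2 ^ (n - 1) + 2 ^ k * (n - k) := by
  have h := dissocNum_le_of_hub (spider n k) ⟨0, by omega⟩ (spiderFeet n k)
    (by simp [spiderFeet]) (by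
      intro x hx hxW
      have hx0 : x.val ≠ 0 := fun e => hx (Fin.ext e)
      refine Or.inr ⟨hx0, ?_⟩
      simp only [spiderFeet, Set.mem_ofPred_eq, not_and] at hxW
      have := hxW hx0
      unfold spiderParent
      rw [if_neg (by omega)])
  rwa [ncard_spiderFeet hn, Fintype.card_fin] at h

theorem le_dissocNum_spider {n k : ℕ} (hn : 2 * k < n) :
    2 ^ (n - 1) + 2 ^ k * (n - 2 * k) ≤ dissocNum (spider n k) := by
  have hL : ({i | 2 * k < i.val} : Set (Fin n)).ncard + 1 = n - 2 * k := by
    have : ({i | 2 * k < i.val} : Set (Fin n)) = ↑(Finset.Ioi (⟨2 * k, hn⟩ : Fin n)) := by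
      ext i
      simp [Fin.lt_def]
    rw [this, Set.ncard_coe_finset, Fin.card_Ioi]
    simp only
    omega
  have h := le_dissocNum_of_hub (spider n k) ⟨0, by omega⟩ (spiderFeet n k) {i | 2 * k < i.val}
    (by simp [spiderFeet]) (by simp) (by
      rw [Set.disjoint_left]
      rintro x ⟨_, _, h⟩ h'
      simp only [Set.mem_ofPred_eq] at h'
      omega) (by
      rintro v hv x ⟨hx, hx0⟩ y ⟨hy, hy0⟩
      have hv' : v.val ≠ 0 := fun e => hv (Fin.ext e)
      have hx' : x.val ≠ 0 := fun e => hx0 (Fin.ext e)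
      have hy' : y.val ≠ 0 := fun e => hy0 (Fin.ext e)
      simp only [mem_neighborSet, spider, spiderParent] at hx hy
      apply Fin.ext
      split_ifs at hx hy <;> omega) (by
      rintro w ⟨h0, h1, h2⟩ h
      simp only [spider, spiderParent] at h
      split_ifs at h <;> omega) (by
      intro l hl x hx
      simp only [Set.mem_ofPred_eq] at hl
      simp only [spider, spiderParent] at hx
      apply Fin.ext
      change x.val = 0
      split_ifs at hx <;> omega)
  rwa [ncard_spiderFeet hn, Fintype.card_fin, hL] at h

theorem exists_adj_of_connected {V : Type*} {G : SimpleGraph V} (hG : G.Connected) {s : Set V}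
    {x y : V} (hx : x ∈ s) (hy : y ∉ s) : ∃ a ∈ s, ∃ b ∉ s, G.Adj a b := by
  obtain ⟨w⟩ := hG.preconnected x y
  obtain ⟨d, -, h1, h2⟩ := w.exists_boundary_dart s hx hy
  exact ⟨d.fst, h1, d.snd, h2, d.adj⟩

/-! ### Growing subtrees -/

/-- A tree on the vertices `0, …, order - 1`: the neighbourhoods as bit masks, together with a
list of bit masks that contains all of its dissociation sets. -/
structure TreeCode where
  /-- the number of vertices -/
  order : ℕ
  /-- the neighbourhoods, as bit masks -/
  nbrs : ℕ → ℕ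
  /-- the dissociation sets, as bit masks -/
  sets : List ℕ

namespace TreeCode

/-- Prepend to `acc` the sets `S ||| v` for those `S` in `L` that avoid `a` or avoid `b`.
(The recursor is used because the kernel evaluates it fast.) -/
noncomputable def extendSets (a b v : ℕ) (acc L : List ℕ) : List ℕ :=
  List.rec acc (fun S _ ih =>
    bif Nat.beq (Nat.land S a) 0 then Nat.lor S v :: ih else
    bif Nat.beq (Nat.land S b) 0 then Nat.lor S v :: ih else ih) L

/-- The length of a list, by the recursor. -/
noncomputable def recLength (L : List ℕ) : ℕ :=
  List.rec (motive := fun _ => ℕ) 0 (fun _ _ ih => Nat.succ ih) L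

theorem recLength_eq (L : List ℕ) : recLength L = L.length := by
  induction L with
  | nil => rfl
  | cons S L ih => exact congrArg Nat.succ ih

theorem extendSets_cons (a b v S : ℕ) (acc L : List ℕ) :
    extendSets a b v acc (S :: L) =
      if S &&& a = 0 ∨ S &&& b = 0 then (S ||| v) :: extendSets a b v acc L
      else extendSets a b v acc L := by
  have hbeq : ∀ x, Nat.beq x 0 = decide (x = 0) := fun x => by cases x <;> rfl
  change (bif Nat.beq (S &&& a) 0 then (S ||| v) :: extendSets a b v acc L else
    bif Nat.beq (S &&& b) 0 then (S ||| v) :: extendSets a b v acc L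
      else extendSets a b v acc L) = _
  by_cases ha : S &&& a = 0 <;> by_cases hb : S &&& b = 0 <;>
    simp [hbeq, ha, hb]

theorem mem_extendSets_of_mem {a b v S : ℕ} {acc : List ℕ} (L : List ℕ) (h : S ∈ acc) :
    S ∈ extendSets a b v acc L := by
  induction L with
  | nil => exact h
  | cons T L ih =>
    rw [extendSets_cons]
    split_ifs
    · exact List.mem_cons_of_mem _ ih
    · exact ih

theorem lor_mem_extendSets {a b v S : ℕ} {acc L : List ℕ} (hS : S ∈ L)
    (h : S &&& a = 0 ∨ S &&& b = 0) : S ||| v ∈ extendSets a b v acc L := by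
  induction L with
  | nil => simp at hS
  | cons T L ih =>
    rw [extendSets_cons]
    rcases List.mem_cons.1 hS with rfl | hS
    · rw [if_pos h]
      exact List.mem_cons_self
    · split_ifs
      · exact List.mem_cons_of_mem _ (ih hS)
      · exact ih hS

/-- The tree with one vertex. -/
def single : TreeCode := ⟨1, fun _ => 0, [0, 1]⟩

/-- Attach a leaf to the vertex `j`. -/
noncomputable def grow (t : TreeCode) (j : ℕ) : TreeCode where
  order := t.order + 1
  nbrs i := if i = j then t.nbrs j ||| 2 ^ t.order else if i = t.order then 2 ^ j else t.nbrs i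
  sets := extendSets (2 ^ j) (t.nbrs j) (2 ^ t.order) t.sets t.sets

/-- Check that at most half of the sets are dissociation sets in every tree obtained from `t` by
attaching at least `fuel` further leaves, none of them to the vertices below `q`. -/
noncomputable def search : ℕ → ℕ → TreeCode → Bool
  | 0, _, t => Nat.ble (2 * recLength t.sets) (2 ^ t.order)
  | fuel + 1, q, t => Nat.ble (2 * recLength t.sets) (2 ^ t.order) ||
      (List.range t.order).all fun j => Nat.blt j q || search fuel j (t.grow j)

/-- The path with six vertices. -/
noncomputable def pathSix : TreeCode := ((((single.grow 0).grow 1).grow 2).grow 3).grow 4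

/-- The tree with two adjacent vertices of degree three and four leaves. -/
noncomputable def doubleStar : TreeCode := ((((single.grow 0).grow 0).grow 0).grow 1).grow 1

theorem search_pathSix : search 5 0 pathSix = true := by decide +kernel

theorem search_doubleStar : search 5 0 doubleStar = true := by decide +kernel

open Classical in
/-- The bit mask of the trace of `S` on `f 0, …, f (m - 1)`. -/
noncomputable def code {V : Type*} (f : ℕ → V) (S : Set V) : ℕ → ℕ
  | 0 => 0
  | m + 1 => if f m ∈ S then code f S m ||| 2 ^ m else code f S m

theorem testBit_code {V : Type*} (f : ℕ → V) (S : Set V) (m i : ℕ) :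
    (code f S m).testBit i = true ↔ i < m ∧ f i ∈ S := by
  induction m with
  | zero => simp [code]
  | succ m ih =>
    unfold code
    by_cases hi : i = m
    · subst hi
      split_ifs with h
      · simp [h]
      · simp [ih, h]
    · have h' : i < m + 1 ↔ i < m := by omega
      split_ifs with h
      · simp [Nat.testBit_or, ih, h', Ne.symm hi]
      · simp [ih, h']

theorem code_congr {V : Type*} {f g : ℕ → V} (S : Set V) {m : ℕ} (h : ∀ i < m, f i = g i) :
    code f S m = code g S m := by
  induction m with
  | zero => rfl
  | succ m ih =>
    unfold code
    rw [ih fun i hi => h i (by omega), h m (by omega)]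

/-- `f 0, …, f (t.order - 1)` are the vertices of a copy of the tree `t` in `G`. -/
structure Realizes {V : Type*} (G : SimpleGraph V) (f : ℕ → V) (t : TreeCode) : Prop where
  inj : ∀ i < t.order, ∀ j < t.order, f i = f j → i = j
  adj : ∀ i < t.order, ∀ j, (t.nbrs i).testBit j = true → j < t.order ∧ G.Adj (f i) (f j)
  mem : ∀ S, IsDissociation G S → code f S t.order ∈ t.sets

theorem Realizes.single {V : Type*} (G : SimpleGraph V) (f : ℕ → V) :
    Realizes G f TreeCode.single where
  inj i hi j hj _ := by
    simp only [TreeCode.single] at hi hj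
    omega
  adj i _ j h := by simp [TreeCode.single] at h
  mem S _ := by
    simp only [TreeCode.single, code]
    split_ifs <;> simp

theorem Realizes.grow {V : Type*} {G : SimpleGraph V} {f : ℕ → V} {t : TreeCode}
    (h : Realizes G f t) {j : ℕ} (hj : j < t.order) (hne : ∀ i < t.order, f i ≠ f t.order)
    (hadj : G.Adj (f j) (f t.order)) : Realizes G f (t.grow j) where
  inj a ha b hb hab := by
    simp only [TreeCode.grow] at ha hb
    rcases Nat.lt_succ_iff_lt_or_eq.1 ha with ha | rfl <;>
      rcases Nat.lt_succ_iff_lt_or_eq.1 hb with hb | rfl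
    · exact h.inj a ha b hb hab
    · exact absurd hab (hne a ha)
    · exact absurd hab.symm (hne b hb)
    · rfl
  adj a ha b hb := by
    simp only [TreeCode.grow] at ha hb ⊢
    split_ifs at hb with h1 h2
    · subst h1
      rw [Nat.testBit_or, Bool.or_eq_true, Nat.testBit_two_pow, decide_eq_true_iff] at hb
      rcases hb with hb | rfl
      · exact ⟨(h.adj a hj b hb).1.trans (Nat.lt_succ_self _), (h.adj a hj b hb).2⟩
      · exact ⟨Nat.lt_succ_self _, hadj⟩
    · rw [Nat.testBit_two_pow, decide_eq_true_iff] at hb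
      subst h2 hb
      exact ⟨ha.trans' (by omega), hadj.symm⟩
    · have := h.adj a (by omega) b hb
      exact ⟨by omega, this.2⟩
  mem S hS := by
    simp only [TreeCode.grow, code]
    split_ifs with hm
    · refine lor_mem_extendSets (h.mem S hS) ?_
      by_contra! hcon
      obtain ⟨h1, h2⟩ := hcon
      have hjS : f j ∈ S := by
        obtain ⟨i, hi⟩ := Nat.exists_testBit_of_ne_zero h1
        rw [Nat.testBit_and, Bool.and_eq_true, testBit_code, Nat.testBit_two_pow,
          decide_eq_true_iff] at hi
        rw [hi.2]
        exact hi.1.2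
      obtain ⟨i, hi⟩ := Nat.exists_testBit_of_ne_zero h2
      rw [Nat.testBit_and, Bool.and_eq_true, testBit_code] at hi
      exact hne i hi.1.1 (hS _ hjS ⟨(h.adj j hj i hi.2).2, hi.1.2⟩ ⟨hadj, hm⟩)
    · exact mem_extendSets_of_mem _ (h.mem S hS)

theorem Realizes.congr {V : Type*} {G : SimpleGraph V} {f g : ℕ → V} {t : TreeCode}
    (h : Realizes G f t) (hfg : ∀ i < t.order, f i = g i) : Realizes G g t where
  inj i hi j hj e := h.inj i hi j hj (by rw [hfg i hi, hfg j hj, e])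
  adj i hi j e := by
    have := h.adj i hi j e
    rw [← hfg i hi, ← hfg j this.1]
    exact this
  mem S hS := by
    rw [← code_congr S hfg]
    exact h.mem S hS

theorem Realizes.dissocNum_le {V : Type*} [Fintype V] {G : SimpleGraph V} {f : ℕ → V}
    {t : TreeCode} (h : Realizes G f t) :
    dissocNum G ≤ t.sets.length * 2 ^ (Fintype.card V - t.order) := by
  classical
  let A : Finset V := (Finset.range t.order).image f
  have hA : A.card = t.order := by
    rw [Finset.card_image_of_injOn, Finset.card_range]
    intro i hi j hj e
    exact h.inj i (by simpa using hi) j (by simpa using hj) e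
  let F : {S : Set V // IsDissociation G S} → {x // x ∈ t.sets.toFinset} × Set {x // x ∉ A} :=
    fun S => (⟨code f S t.order, by simpa using h.mem S S.2⟩, {x | x.1 ∈ S.1})
  have hF : Function.Injective F := by
    intro S T e
    simp only [F, Prod.mk.injEq, Subtype.mk.injEq] at e
    apply Subtype.ext
    ext x
    by_cases hx : x ∈ A
    · obtain ⟨i, hi, rfl⟩ := Finset.mem_image.1 hx
      rw [Finset.mem_range] at hi
      have h1 := testBit_code f S.1 t.order i
      have h2 := testBit_code f T.1 t.order i
      rw [e.1] at h1
      have := h1.symm.trans h2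
      simpa [hi] using this
    · exact Set.ext_iff.1 e.2 ⟨x, hx⟩
  refine (Nat.card_le_card_of_injective F hF).trans ?_
  rw [Nat.card_prod]
  refine Nat.mul_le_mul ?_ (le_of_eq ?_)
  · rw [Nat.card_eq_fintype_card, Fintype.card_coe]
    exact List.toFinset_card_le t.sets
  · rw [Nat.card_eq_fintype_card, Fintype.card_set, Fintype.card_subtype_compl,
      Fintype.card_coe, hA]

theorem Realizes.two_mul_dissocNum_le_of_ble {V : Type*} [Fintype V] {G : SimpleGraph V}
    {f : ℕ → V} {t : TreeCode} (h : Realizes G f t) (hcard : t.order ≤ Fintype.card V)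
    (hle : Nat.ble (2 * recLength t.sets) (2 ^ t.order) = true) :
    2 * dissocNum G ≤ 2 ^ Fintype.card V := by
  rw [Nat.ble_eq, recLength_eq] at hle
  calc 2 * dissocNum G ≤ 2 * (t.sets.length * 2 ^ (Fintype.card V - t.order)) :=
        Nat.mul_le_mul_left _ h.dissocNum_le
    _ = 2 * t.sets.length * 2 ^ (Fintype.card V - t.order) := by ring
    _ ≤ 2 ^ t.order * 2 ^ (Fintype.card V - t.order) := Nat.mul_le_mul_right _ hle
    _ = 2 ^ Fintype.card V := by
        rw [← pow_add]
        congr 1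
        omega

theorem Realizes.two_mul_dissocNum_le {V : Type*} [Fintype V] {G : SimpleGraph V}
    (hG : G.Connected) (fuel : ℕ) {q : ℕ} {f : ℕ → V} {t : TreeCode} (h : Realizes G f t)
    (h0 : 0 < t.order) (hcard : t.order + fuel ≤ Fintype.card V)
    (hq : ∀ i < q, ∀ v, G.Adj (f i) v → ∃ j < t.order, f j = v)
    (hs : search fuel q t = true) : 2 * dissocNum G ≤ 2 ^ Fintype.card V := by
  classical
  induction fuel generalizing q f t with
  | zero => exact h.two_mul_dissocNum_le_of_ble hcard hs
  | succ fuel ih =>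
    unfold search at hs
    rw [Bool.or_eq_true] at hs
    rcases hs with hs | hs
    · exact h.two_mul_dissocNum_le_of_ble (by omega) hs
    obtain ⟨y, hy⟩ : ∃ y, y ∉ (Finset.range t.order).image f := by
      by_contra! hall
      have h1 : Fintype.card V ≤ ((Finset.range t.order).image f).card := by
        rw [← Finset.card_univ]
        exact Finset.card_le_card fun x _ => hall x
      have h2 := h1.trans Finset.card_image_le
      rw [Finset.card_range] at h2
      omega
    have hex : ∃ j, j < t.order ∧ ∃ v, G.Adj (f j) v ∧ ∀ i < t.order, f i ≠ v := by
      obtain ⟨a, ha, b, hb, hab⟩ := exists_adj_of_connected hG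
        (s := ((Finset.range t.order).image f : Finset V)) (x := f 0) (y := y)
        (by simpa using ⟨0, h0, rfl⟩) (by simpa using hy)
      simp only [Finset.coe_image, Finset.coe_range, Set.mem_image, Set.mem_Iio] at ha hb
      obtain ⟨j, hj, rfl⟩ := ha
      exact ⟨j, hj, b, hab, fun i hi e => hb ⟨i, hi, e⟩⟩
    obtain ⟨hj, v, hv, hne⟩ := Nat.find_spec hex
    have hmin := fun {i} => Nat.find_min (m := i) hex
    set j := Nat.find hex
    have hqj : q ≤ j := by
      by_contra! hlt
      obtain ⟨i, hi, e⟩ := hq j hlt v hv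
      exact hne i hi e
    have hf : ∀ i < t.order, f i = Function.update f t.order v i := fun i hi => by
      rw [Function.update_of_ne hi.ne]
    have hnew : Realizes G (Function.update f t.order v) (t.grow j) := by
      refine (h.congr hf).grow hj (fun i hi => ?_) ?_
      · rw [← hf i hi, Function.update_self]
        exact hne i hi
      · rw [← hf j hj, Function.update_self]
        exact hv
    rw [List.all_eq_true] at hs
    have hs' := hs j (List.mem_range.2 hj)
    rw [Bool.or_eq_true, Nat.blt_eq] at hs'
    have hcard' : (t.grow j).order + fuel ≤ Fintype.card V := by
      simp only [TreeCode.grow]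
      omega
    refine ih hnew (Nat.succ_pos _) hcard' (fun i hi w hw => ?_) (hs'.resolve_left (by omega))
    rw [← hf i (hi.trans hj)] at hw
    have := hmin hi
    push Not at this
    obtain ⟨k, hk, e⟩ := this (hi.trans hj) w hw
    exact ⟨k, hk.trans (Nat.lt_succ_self _), by rw [← hf k hk, e]⟩

end TreeCode

/-! ### Trees of diameter different from four -/

open TreeCode in
theorem two_mul_dissocNum_le_of_path_six {V : Type*} [Fintype V] {G : SimpleGraph V}
    (hG : G.Connected) (hcard : 11 ≤ Fintype.card V) {f : ℕ → V}
    (hinj : ∀ i ≤ 5, ∀ j ≤ 5, f i = f j → i = j) (hadj : ∀ i < 5, G.Adj (f i) (f (i + 1))) :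
    2 * dissocNum G ≤ 2 ^ Fintype.card V := by
  have hne : ∀ m ≤ 5, ∀ i < m, f i ≠ f m := fun m hm i hi e =>
    hi.ne (hinj i (by omega) m hm e)
  have h : Realizes G f pathSix :=
    (((((Realizes.single G f).grow (j := 0) (by decide) (hne 1 (by omega)) (hadj 0 (by omega))).grow
      (j := 1) (by decide) (hne 2 (by omega)) (hadj 1 (by omega))).grow
      (j := 2) (by decide) (hne 3 (by omega)) (hadj 2 (by omega))).grow
      (j := 3) (by decide) (hne 4 (by omega)) (hadj 3 (by omega))).grow
      (j := 4) (by decide) (hne 5 (by omega)) (hadj 4 (by omega))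
  exact h.two_mul_dissocNum_le hG 5 (q := 0) (by decide) hcard (by simp) search_pathSix

open TreeCode in
theorem two_mul_dissocNum_le_of_doubleStar {V : Type*} [Fintype V] {G : SimpleGraph V}
    (hG : G.Connected) (hcard : 11 ≤ Fintype.card V) {u v a a' b b' : V}
    (hnd : [u, v, a, a', b, b'].Nodup) (huv : G.Adj u v) (ha : G.Adj u a) (ha' : G.Adj u a')
    (hb : G.Adj v b) (hb' : G.Adj v b') :
    2 * dissocNum G ≤ 2 ^ Fintype.card V := by
  let f : ℕ → V := fun i => [u, v, a, a', b, b'].getD i u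
  have hne : ∀ m < 6, ∀ i < m, f i ≠ f m := by
    simp only [List.nodup_cons, List.mem_cons, not_or, List.not_mem_nil] at hnd
    intro m hm i hi
    interval_cases m <;> interval_cases i <;> simp only [f, List.getD_cons_zero,
      List.getD_cons_succ] <;> tauto
  have h : Realizes G f doubleStar :=
    (((((Realizes.single G f).grow (j := 0) (by decide) (hne 1 (by omega)) huv).grow
      (j := 0) (by decide) (hne 2 (by omega)) ha).grow
      (j := 0) (by decide) (hne 3 (by omega)) ha').grow
      (j := 1) (by decide) (hne 4 (by omega)) hb).grow
      (j := 1) (by decide) (hne 5 (by omega)) hb'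
  exact h.two_mul_dissocNum_le hG 5 (q := 0) (by decide) hcard (by simp) search_doubleStar

theorem exists_path_three {V : Type*} [Fintype V] {G : SimpleGraph V} (hG : G.Connected)
    (hcard : 3 ≤ Fintype.card V) : ∃ u a b, a ≠ b ∧ G.Adj u a ∧ G.Adj u b := by
  classical
  have hex : ∀ s : Finset V, s.card < 3 → ∃ y, y ∉ (s : Set V) := by
    intro s hs
    by_contra! h
    have := Finset.card_le_card (fun x _ => h x : Finset.univ ⊆ s)
    rw [Finset.card_univ] at this
    omega
  obtain ⟨x⟩ := hG.nonempty
  obtain ⟨y, hy⟩ := hex {x} (by simp)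
  obtain ⟨x, -, y, hy, hxy⟩ := exists_adj_of_connected hG (Finset.mem_coe.2
    (Finset.mem_singleton_self x)) hy
  obtain ⟨z, hz⟩ := hex {x, y} (Finset.card_le_two.trans_lt (by omega))
  obtain ⟨c, hc, z, hz, hcz⟩ := exists_adj_of_connected hG (Finset.mem_coe.2
    (Finset.mem_insert_self x {y})) hz
  simp only [Finset.coe_insert, Finset.coe_singleton, Set.mem_insert_iff,
    Set.mem_singleton_iff, not_or] at hc hz
  rcases hc with rfl | rfl
  · exact ⟨c, y, z, Ne.symm hz.2, hxy, hcz⟩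
  · exact ⟨c, x, z, Ne.symm hz.1, hxy.symm, hcz⟩

theorem dissocNum_le_of_no_path_five {V : Type*} [Fintype V] {G : SimpleGraph V}
    (hG : G.IsTree) (hcard : 11 ≤ Fintype.card V)
    (hno : ∀ x₀ x₁ x₂ x₃ x₄, G.Adj x₀ x₁ → G.Adj x₁ x₂ → G.Adj x₂ x₃ → G.Adj x₃ x₄ →
      ¬ [x₀, x₁, x₂, x₃, x₄].Nodup) :
    dissocNum G ≤ 2 ^ (Fintype.card V - 1) + 2 * (Fintype.card V - 1) := by
  classical
  have hconn := hG.connected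
  have near_star : ∀ c w, c ≠ w → (∀ x, x ≠ c → x ≠ w → G.Adj c x) →
      dissocNum G ≤ 2 ^ (Fintype.card V - 1) + 2 * (Fintype.card V - 1) := by
    intro c w hcw h
    simpa using dissocNum_le_of_hub G c {w} (by simpa using hcw) (by simpa using h)
  have tri : ∀ x y z, G.Adj x y → G.Adj y z → ¬ G.Adj x z := by
    intro x y z h1 h2 h3
    exact hG.isAcyclic.cliqueFree le_rfl {x, y, z} (is3Clique_triple_iff.2 ⟨h1, h3, h2⟩)
  obtain ⟨u, a, b, hab, hua, hub⟩ := exists_path_three hconn (by omega)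
  by_cases hstar : ∀ x, x ≠ u → G.Adj u x
  · exact near_star u a hua.ne fun x hx _ => hstar x hx
  obtain ⟨a, u, v, b, hau, huv, hvb, hnd⟩ :
      ∃ a u v b, G.Adj a u ∧ G.Adj u v ∧ G.Adj v b ∧ [a, u, v, b].Nodup := by
    push Not at hstar
    obtain ⟨y, hyu, hy⟩ := hstar
    obtain ⟨v, hv, y, hy, hvy⟩ := exists_adj_of_connected hconn
      (s := {x | x = u ∨ G.Adj u x}) (x := u) (y := y) (Or.inl rfl) (by
        rintro (h | h)
        exacts [hyu h, hy h])
    simp only [Set.mem_ofPred_eq, not_or] at hy hv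
    have huv : G.Adj u v := hv.resolve_left fun e => hy.2 (e ▸ hvy)
    have key : ∀ a, G.Adj u a → a ≠ v → ∃ a u v b, G.Adj a u ∧ G.Adj u v ∧ G.Adj v b ∧
        [a, u, v, b].Nodup := fun a hua hav =>
      ⟨a, u, v, y, hua.symm, huv, hvy, by
        have h1 : a ≠ y := fun e => hy.2 (e ▸ hua)
        simp [hua.ne', hav, h1, huv.ne, Ne.symm hy.1, hvy.ne]⟩
    by_cases hav : a = v
    · exact key b hub fun h => hab (hav.trans h.symm)
    · exact key a hua hav
  simp only [List.nodup_cons, List.mem_cons, List.not_mem_nil, or_false, not_or,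
    not_false_eq_true, List.nodup_nil, and_true] at hnd
  obtain ⟨⟨hau', hav, hab⟩, ⟨huv', hub⟩, hvb'⟩ := hnd
  have hcover : ∀ x, x = u ∨ x = v ∨ G.Adj u x ∨ G.Adj v x := by
    by_contra! h
    obtain ⟨y, h1, h2, h3, h4⟩ := h
    obtain ⟨x, hx, y, hy, hxy⟩ := exists_adj_of_connected hconn
      (s := {x | x = u ∨ x = v ∨ G.Adj u x ∨ G.Adj v x}) (x := u) (y := y) (Or.inl rfl)
      (by
        rintro (h | h | h | h)
        exacts [h1 h, h2 h, h3 h, h4 h])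
    simp only [Set.mem_ofPred_eq, not_or] at hy hx
    obtain ⟨hyu, hyv, hyu', hyv'⟩ := hy
    have hxu : x ≠ u := fun e => hyu' (e ▸ hxy)
    have hxv : x ≠ v := fun e => hyv' (e ▸ hxy)
    have hya : y ≠ a := fun e => hyu' (e ▸ hau.symm)
    have hyb : y ≠ b := fun e => hyv' (e ▸ hvb)
    rcases (hx.resolve_left hxu).resolve_left hxv with hux | hvx
    · have hxb : x ≠ b := fun e => tri u v b huv hvb (e ▸ hux)
      refine hno y x u v b hxy.symm hux.symm huv hvb ?_
      simp [hxy.ne', hyu, hyv, hyb, hxu, hxv, hxb, huv', hub, hvb']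
    · have hxa : x ≠ a := fun e => tri a u v hau huv (e ▸ hvx.symm)
      refine hno y x v u a hxy.symm hvx.symm huv.symm hau.symm ?_
      simp [hxy.ne', hyu, hyv, hya, hxu, hxv, hxa, Ne.symm huv', Ne.symm hav, Ne.symm hau']
  by_cases ha' : ∃ a', G.Adj u a' ∧ a' ≠ a ∧ a' ≠ v
  · by_cases hb' : ∃ b', G.Adj v b' ∧ b' ≠ b ∧ b' ≠ u
    · obtain ⟨a', hua', ha'a, ha'v⟩ := ha'
      obtain ⟨b', hvb', hb'b, hb'u⟩ := hb'
      have hdis : ∀ x y, G.Adj u x → G.Adj v y → x ≠ y := fun x y hx hy e =>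
        tri u v y huv hy (e ▸ hx)
      have h := two_mul_dissocNum_le_of_doubleStar hconn hcard (u := u) (v := v) (a := a)
        (a' := a') (b := b) (b' := b') (by
          simp [huv.ne, hau.ne', hua'.ne, hub, Ne.symm hb'u, Ne.symm hav, Ne.symm ha'v, hvb.ne,
            hvb'.ne, Ne.symm ha'a, hab, hdis a b' hau.symm hvb', hdis a' b hua' hvb,
            hdis a' b' hua' hvb', Ne.symm hb'b]) huv hau.symm hua' hvb hvb'
      have h2 : 2 ^ Fintype.card V = 2 * 2 ^ (Fintype.card V - 1) := by
        rw [← pow_succ']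
        congr 1
        omega
      omega
    · push Not at hb'
      refine near_star u b hub fun x hxu hxb => ?_
      rcases hcover x with h | h | h | h
      · exact absurd h hxu
      · exact h ▸ huv
      · exact h
      · exact absurd (hb' x h hxb) hxu
  · push Not at ha'
    refine near_star v a (Ne.symm hav) fun x hxv hxa => ?_
    rcases hcover x with h | h | h | h
    · exact h ▸ huv.symm
    · exact absurd h hxv
    · exact absurd (ha' x h hxa) hxv
    · exact h

/-- For `n ≥ 11`, every longest path of a tree of order `n` with the second-largest
number of dissociation sets has exactly 5 vertices (length 4), i.e. the tree has
diameter 4. -/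
theorem longest_path_length_four (n : ℕ) (h11 : 11 ≤ n)
    (T : SimpleGraph (Fin n)) (hT : SecondLargestTree n T)
    (a b : Fin n) (p : T.Walk a b) (hp : p.IsPath)
    (hlong : ∀ (c d : Fin n) (q : T.Walk c d), q.IsPath → q.length ≤ p.length) :
    p.length = 4 := by
  obtain ⟨htree, -, hmax⟩ := hT
  have hspider : dissocNum (spider n 2) ≤ dissocNum T :=
    hmax _ (spider_isTree n 2 (by omega)) ⟨spider n 3, spider_isTree n 3 (by omega), by
      have h2 := dissocNum_spider_le (n := n) (k := 2) (by omega)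
      have h3 := le_dissocNum_spider (n := n) (k := 3) (by omega)
      omega⟩
  have hlow := le_dissocNum_spider (n := n) (k := 2) (by omega)
  have hcard : 11 ≤ Fintype.card (Fin n) := by rwa [Fintype.card_fin]
  rcases lt_trichotomy p.length 4 with h | h | h
  · have hle := dissocNum_le_of_no_path_five htree hcard (by
      intro x₀ x₁ x₂ x₃ x₄ h₀ h₁ h₂ h₃ hnd
      have := hlong _ _ (.cons h₀ (.cons h₁ (.cons h₂ (.cons h₃ .nil))))
        (Walk.isPath_def _ |>.2 (by simpa using hnd))
      simp only [Walk.length_cons, Walk.length_nil] at this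
      omega)
    rw [Fintype.card_fin] at hle
    omega
  · exact h
  · have hle := two_mul_dissocNum_le_of_path_six htree.connected hcard (f := p.getVert)
      (fun i hi j hj e => hp.getVert_injOn (by simp; omega) (by simp; omega) e)
      (fun i hi => p.adj_getVert_succ (by omega))
    rw [Fintype.card_fin] at hle
    have h2 : 2 ^ n = 2 * 2 ^ (n - 1) := by
      rw [← pow_succ']
      congr 1
      omega
    omega
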